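/- Let M = ⟨S,A,Φ,P,R⟩ be a finite MDP and let B_0 be the partition of Φ whose blocks are the nonempty level sets of the reward function R. Suppose B_0, B_1, …, B_n is a sequence of partitions of Φ such that for each k < n there exist a block b_k of B_k and a union C_k of blocks of B_k|S with B_{k+1} = Split(b_k, C_k, B_k). Then every reward respecting SSP partition of Φ is a refinement of B_k for every k ≤ n. -/

import Mathlib

open Classical in
/-- Block transition probability `T(s,a,C) = Σ_{s'' ∈ C} P(s,a,s'')`. -/
noncomputable def blockT {S A : Type} [Fintype S] (P : S → A → S → ℝ)
    (s : S) (a : A) (C : Set S) : ℝ :=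
  ∑ s' : S, if s' ∈ C then P s a s' else 0

/-- `B` is a partition of the set `Φ`. -/
def IsPartition {X : Type} (Φ : Set X) (B : Set (Set X)) : Prop :=
  (∀ b ∈ B, b.Nonempty) ∧ (⋃₀ B = Φ) ∧
    (∀ b ∈ B, ∀ c ∈ B, b ≠ c → Disjoint b c)

/-- `p` and `q` lie in the same block of `B`. -/
def SameBlock {X : Type} (B : Set (Set X)) (p q : X) : Prop :=
  ∃ b ∈ B, p ∈ b ∧ q ∈ b

/-- `B(s)`: the set of blocks of `B` containing a pair whose state component is `s`. -/
def stateBlocks {S A : Type} (B : Set (Set (S × A))) (s : S) : Set (Set (S × A)) :=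
  {b ∈ B | ∃ a, (s, a) ∈ b}

/-- The block `[s]_{B|S}` of the projection `B|S` containing the state `s`. -/
def projBlock {S A : Type} (B : Set (Set (S × A))) (s : S) : Set S :=
  {s' | stateBlocks B s' = stateBlocks B s}

/-- The projection `B|S` of a state-action partition `B` onto the state space. -/
def proj {S A : Type} (B : Set (Set (S × A))) : Set (Set S) :=
  Set.range (projBlock B)

/-- `B'` is a refinement of `B`: every block of `B'` is a subset of some block of `B`. -/
def Refines {X : Type} (B' B : Set (Set X)) : Prop :=
  ∀ b' ∈ B', ∃ b ∈ B, b' ⊆ b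

/-- `C` is a union of blocks of the partition `B`. -/
def UnionOfBlocks {X : Type} (B : Set (Set X)) (C : Set X) : Prop :=
  ∃ 𝒞 ⊆ B, C = ⋃₀ 𝒞

/-- A partition is reward respecting if state-action pairs in the same block
get the same reward. -/
def RewardRespecting {S A : Type} (R : S → A → ℝ) (B : Set (Set (S × A))) : Prop :=
  ∀ p q : S × A, SameBlock B p q → R p.1 p.2 = R q.1 q.2

/-- Stochastic substitution property. -/
def SSP {S A : Type} [Fintype S] (P : S → A → S → ℝ) (B : Set (Set (S × A))) : Prop :=
  ∀ p q : S × A, SameBlock B p q →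
    ∀ c ∈ proj B, blockT P p.1 p.2 c = blockT P q.1 q.2 c

/-- `Split(b,C,B)`: replace the block `b` of `B` by the nonempty level sets of
`(s,a) ↦ T(s,a,C)` restricted to `b`. -/
def split {S A : Type} [Fintype S] (P : S → A → S → ℝ) (b : Set (S × A)) (C : Set S)
    (B : Set (Set (S × A))) : Set (Set (S × A)) :=
  (B \ {b}) ∪ {d | d.Nonempty ∧ ∃ r : ℝ, d = {p ∈ b | blockT P p.1 p.2 C = r}}

/-- The conditions making `⟨S,A,Φ,P,R⟩` a finite MDP: every state has an admissible
action, and `P(s,a,·)` is a probability distribution for each admissible `(s,a)`. -/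
def IsMDP {S A : Type} [Fintype S] [Fintype A] (Φ : Set (S × A))
    (P : S → A → S → ℝ) : Prop :=
  (∀ s : S, ∃ a : A, (s, a) ∈ Φ) ∧
  (∀ p ∈ Φ, ∀ s' : S, 0 ≤ P p.1 p.2 s' ∧ P p.1 p.2 s' ≤ 1) ∧
  (∀ p ∈ Φ, ∑ s' : S, P p.1 p.2 s' = 1)

/-- The canonical quotient map sending a state to its block of `B|S`. -/
def quotientMap {S A : Type} (B : Set (Set (S × A))) (s : S) : ↥(proj B) :=
  ⟨projBlock B s, ⟨s, rfl⟩⟩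

/-- `⟨f, {g_s}⟩` is an MDP homomorphism. -/
def IsMDPHom {S A S' A' : Type} [Fintype S]
    (Φ : Set (S × A)) (P : S → A → S → ℝ) (R : S → A → ℝ)
    (Φ' : Set (S' × A')) (P' : S' → A' → S' → ℝ) (R' : S' → A' → ℝ)
    (f : S → S') (g : S → A → A') : Prop :=
  Function.Surjective f ∧
  (∀ p ∈ Φ, (f p.1, g p.1 p.2) ∈ Φ') ∧
  (∀ s : S, ∀ a' : A', (f s, a') ∈ Φ' → ∃ a : A, (s, a) ∈ Φ ∧ g s a = a') ∧
  (∀ p ∈ Φ, R p.1 p.2 = R' (f p.1) (g p.1 p.2)) ∧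
  (∀ p ∈ Φ, ∀ s' : S,
    blockT P p.1 p.2 {s'' | f s'' = f s'} = P' (f p.1) (g p.1 p.2) (f s'))

/-- `Q` satisfies the Bellman optimality equation for the MDP `⟨S,A,Φ,P,R⟩`
with discount factor `γ`. -/
noncomputable def IsBellmanSolution {S A : Type} [Fintype S] (Φ : Set (S × A))
    (P : S → A → S → ℝ) (R : S → A → ℝ) (γ : ℝ) (Q : S → A → ℝ) : Prop :=
  ∀ p ∈ Φ, Q p.1 p.2 = R p.1 p.2 +
    γ * ∑ s' : S, P p.1 p.2 s' * sSup {x : ℝ | ∃ a'' : A, (s', a'') ∈ Φ ∧ x = Q s' a''}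

theorem projBlock_eq_iff {S A : Type} {B : Set (Set (S × A))} {s t : S} :
    projBlock B s = projBlock B t ↔ stateBlocks B s = stateBlocks B t := by
  refine ⟨fun h => ?_, fun h => ?_⟩
  · have hs : s ∈ projBlock B s := rfl
    rw [h] at hs
    exact hs
  · simp only [projBlock, h]

open Classical in
/-- The transition probability to a set saturated under `B|S` is the sum of the transition
probabilities to the blocks of `B|S` it contains. -/
theorem blockT_eq_sum_projBlock {S A : Type} [Fintype S] (P : S → A → S → ℝ)
    (B : Set (Set (S × A))) (C : Set S) (hC : ∀ s ∈ C, projBlock B s ⊆ C) (s : S) (a : A) :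
    blockT P s a C =
      ∑ c ∈ Finset.univ.image (projBlock B), if c ⊆ C then blockT P s a c else 0 := by
  rw [blockT, ← Finset.sum_fiberwise_of_maps_to (g := projBlock B)
    (fun x hx => Finset.mem_image_of_mem (projBlock B) hx)]
  refine Finset.sum_congr rfl fun c hc => ?_
  obtain ⟨t, -, rfl⟩ := Finset.mem_image.1 hc
  rw [Finset.sum_filter, blockT]
  by_cases h : projBlock B t ⊆ C
  · rw [if_pos h]
    refine Finset.sum_congr rfl fun u _ => ?_
    by_cases hu : u ∈ projBlock B t
    · rw [if_pos (projBlock_eq_iff.2 hu), if_pos (h hu), if_pos hu]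
    · rw [if_neg fun h' => hu (projBlock_eq_iff.1 h'), if_neg hu]
  · rw [if_neg h]
    refine Finset.sum_eq_zero fun u _ => ?_
    split_ifs with hu huC
    · exact absurd (hu ▸ hC u huC) h
    · rfl
    · rfl

/-- The transition probability to a set saturated under `B|S` is constant on the blocks of an
SSP partition `B`. -/
theorem SSP.blockT_eq {S A : Type} [Fintype S] {P : S → A → S → ℝ} {B : Set (Set (S × A))}
    (h : SSP P B) {C : Set S} (hC : ∀ s ∈ C, projBlock B s ⊆ C) {p q : S × A}
    (hpq : SameBlock B p q) : blockT P p.1 p.2 C = blockT P q.1 q.2 C := by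
  classical
  rw [blockT_eq_sum_projBlock P B C hC, blockT_eq_sum_projBlock P B C hC]
  refine Finset.sum_congr rfl fun c hc => ?_
  obtain ⟨t, -, rfl⟩ := Finset.mem_image.1 hc
  rw [h p q hpq _ ⟨t, rfl⟩]

theorem isPartition_levelSets {X : Type} (Φ : Set X) (f : X → ℝ) :
    IsPartition Φ {d | d.Nonempty ∧ ∃ r : ℝ, d = {p ∈ Φ | f p = r}} := by
  refine ⟨fun b hb => hb.1, ?_, ?_⟩
  · ext x
    refine ⟨?_, fun hx => ⟨{p ∈ Φ | f p = f x}, ⟨⟨x, hx, rfl⟩, f x, rfl⟩, hx, rfl⟩⟩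
    rintro ⟨_, ⟨-, r, rfl⟩, hx⟩
    exact hx.1
  · rintro _ ⟨-, r, rfl⟩ _ ⟨-, r', rfl⟩ hne
    refine Set.disjoint_left.2 fun x hx hx' => hne ?_
    rw [← hx.2, ← hx'.2]

theorem IsPartition.split {S A : Type} [Fintype S] {Φ : Set (S × A)} {B : Set (Set (S × A))}
    (hB : IsPartition Φ B) (P : S → A → S → ℝ) {b : Set (S × A)} (hb : b ∈ B) (C : Set S) :
    IsPartition Φ (split P b C B) := by
  obtain ⟨hne, hU, hdisj⟩ := hB
  obtain ⟨hne', hU', hdisj'⟩ := isPartition_levelSets b fun p => blockT P p.1 p.2 C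
  refine ⟨?_, ?_, ?_⟩
  · rintro c (hc | hc)
    · exact hne c hc.1
    · exact hne' c hc
  · rw [_root_.split, Set.sUnion_union, hU', ← hU]
    conv_rhs => rw [← Set.sdiff_union_of_subset (Set.singleton_subset_iff.2 hb),
      Set.sUnion_union, Set.sUnion_singleton]
  · have hsub : ∀ d, (d.Nonempty ∧ ∃ r : ℝ, d = {p ∈ b | blockT P p.1 p.2 C = r}) → d ⊆ b := by
      rintro _ ⟨-, r, rfl⟩ x hx
      exact hx.1
    rintro c (hc | hc) d (hd | hd) hcd
    · exact hdisj c hc.1 d hd.1 hcd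
    · exact (hdisj c hc.1 b hb hc.2).mono_right (hsub d hd)
    · exact (hdisj b hb d hd.1 (Ne.symm hd.2)).mono_left (hsub c hc)
    · exact hdisj' c hc d hd hcd

theorem Refines.stateBlocks_subset {S A : Type} {Φ : Set (S × A)} {B B' : Set (Set (S × A))}
    (h : Refines B' B) (hB : IsPartition Φ B) (hB' : IsPartition Φ B') {s t : S}
    (hst : stateBlocks B' s ⊆ stateBlocks B' t) : stateBlocks B s ⊆ stateBlocks B t := by
  rintro b ⟨hb, a, ha⟩
  have hΦ : (s, a) ∈ ⋃₀ B' := by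
    rw [hB'.2.1, ← hB.2.1]
    exact ⟨b, hb, ha⟩
  obtain ⟨b', hb', ha'⟩ := hΦ
  obtain ⟨c, hc, hbc⟩ := h b' hb'
  obtain rfl : b = c := by
    by_contra hne
    exact Set.disjoint_left.1 (hB.2.2 b hb c hc hne) ha (hbc ha')
  obtain ⟨-, a', ht⟩ := hst ⟨hb', a, ha'⟩
  exact ⟨hb, a', hbc ht⟩

/-- If `B'` refines `B`, then `B'|S` refines `B|S`. -/
theorem Refines.projBlock_subset {S A : Type} {Φ : Set (S × A)} {B B' : Set (Set (S × A))}
    (h : Refines B' B) (hB : IsPartition Φ B) (hB' : IsPartition Φ B') (s : S) :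
    projBlock B' s ⊆ projBlock B s := fun _ ht =>
  (h.stateBlocks_subset hB hB' (Eq.subset ht)).antisymm
    (h.stateBlocks_subset hB hB' (Eq.subset (Eq.symm ht)))

theorem Refines.split {S A : Type} [Fintype S] {Φ : Set (S × A)} {B B' : Set (Set (S × A))}
    {P : S → A → S → ℝ} (h : Refines B' B) (hB : IsPartition Φ B) (hB' : IsPartition Φ B')
    (hSSP : SSP P B') (b : Set (S × A)) {C : Set S} (hC : UnionOfBlocks (proj B) C) :
    Refines B' (split P b C B) := by
  have hsat : ∀ s ∈ C, projBlock B' s ⊆ C := by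
    obtain ⟨D, hD, rfl⟩ := hC
    rintro s ⟨c, hc, hs⟩ t ht
    obtain ⟨u, rfl⟩ := hD hc
    refine ⟨_, hc, ?_⟩
    rw [← projBlock_eq_iff.2 hs]
    exact h.projBlock_subset hB hB' s ht
  intro b' hb'
  obtain ⟨c, hc, hbc⟩ := h b' hb'
  by_cases hcb : c = b
  · subst hcb
    obtain ⟨p, hp⟩ := hB'.1 b' hb'
    exact ⟨{q ∈ c | blockT P q.1 q.2 C = blockT P p.1 p.2 C},
      Or.inr ⟨⟨p, hbc hp, rfl⟩, _, rfl⟩,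
      fun q hq => ⟨hbc hq, hSSP.blockT_eq hsat ⟨b', hb', hq, hp⟩⟩⟩
  · exact ⟨c, Or.inl ⟨hc, hcb⟩, hbc⟩

theorem RewardRespecting.refines_levelSets {S A : Type} {Φ : Set (S × A)} {R : S → A → ℝ}
    {B : Set (Set (S × A))} (h : RewardRespecting R B) (hB : IsPartition Φ B) :
    Refines B {d | d.Nonempty ∧ ∃ r : ℝ, d = {p ∈ Φ | R p.1 p.2 = r}} := by
  intro b hb
  have hsub : b ⊆ Φ := hB.2.1 ▸ Set.subset_sUnion_of_mem hb
  obtain ⟨p, hp⟩ := hB.1 b hb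
  exact ⟨{q ∈ Φ | R q.1 q.2 = R p.1 p.2}, ⟨⟨p, hsub hp, rfl⟩, _, rfl⟩,
    fun q hq => ⟨hsub hq, h q p ⟨b, hb, hq, hp⟩⟩⟩

/-- Starting from the partition of `Φ` into nonempty level sets of the
reward function and repeatedly applying `Split` with a block and a union of blocks of the
current projection, every reward respecting SSP partition of `Φ` refines every partition
in the resulting sequence. -/
theorem stmt4 {S A : Type} [Fintype S] [Fintype A]
    (Φ : Set (S × A)) (P : S → A → S → ℝ) (R : S → A → ℝ)
    (hM : IsMDP Φ P)
    (n : ℕ) (Bs : ℕ → Set (Set (S × A)))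
    (h0 : Bs 0 = {d | d.Nonempty ∧ ∃ r : ℝ, d = {p ∈ Φ | R p.1 p.2 = r}})
    (hstep : ∀ k < n, ∃ b ∈ Bs k, ∃ C : Set S,
      UnionOfBlocks (proj (Bs k)) C ∧ Bs (k + 1) = split P b C (Bs k))
    (B' : Set (Set (S × A))) (hB' : IsPartition Φ B')
    (hRR' : RewardRespecting R B') (hSSP' : SSP P B') :
    ∀ k ≤ n, Refines B' (Bs k) := by
  suffices h : ∀ k ≤ n, IsPartition Φ (Bs k) ∧ Refines B' (Bs k) from fun k hk => (h k hk).2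
  intro k
  induction k with
  | zero =>
    intro _
    rw [h0]
    exact ⟨isPartition_levelSets Φ fun p => R p.1 p.2, hRR'.refines_levelSets hB'⟩
  | succ k ih =>
    intro hk
    obtain ⟨hpart, href⟩ := ih (Nat.le_of_succ_le hk)
    obtain ⟨b, hb, C, hC, hsplit⟩ := hstep k hk
    rw [hsplit]
    exact ⟨hpart.split P hb C, href.split hpart hB' hSSP' b hC⟩
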